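/- Let f : [x_1, x_L]^N → ℝ be convex and 1-Lipschitz (with respect to the Euclidean norm). Then for every t ≥ 0, P_κ(f − E_κ f ≥ t) ≤ exp(− t² / (16 |𝒳|²)). -/

import Mathlib

open Finset Real
open scoped Classical

noncomputable section

/-- The multislice `Ω_κ ⊆ 𝒳^N`: vectors with values in `{x ℓ}` where the value `x ℓ`
appears exactly `κ ℓ` times. -/
def multislice (L N : ℕ) (κ : Fin L → ℕ) (x : Fin L → ℝ) : Finset (Fin N → ℝ) :=
  (Fintype.piFinset fun _ : Fin N => Finset.image x Finset.univ).filter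
    (fun ω => ∀ ℓ : Fin L, (Finset.univ.filter fun i => ω i = x ℓ).card = κ ℓ)

/-- Expectation with respect to the uniform distribution on a finite set. -/
def uexpect {α : Type*} (Ω : Finset α) (f : α → ℝ) : ℝ := (∑ ω ∈ Ω, f ω) / Ω.card

/-- Probability of an event with respect to the uniform distribution on a finite set. -/
def uprob {α : Type*} (Ω : Finset α) (p : α → Prop) : ℝ :=
  ((Ω.filter p).card : ℝ) / Ω.card

/-- The symmetrized relative entropy integrand. -/
def logDiff (a b : ℝ) : ℝ := (a - b) * (log a - log b)

theorem logDiff_self (a : ℝ) : logDiff a a = 0 := by simp [logDiff]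

theorem logDiff_nonneg {a b : ℝ} (ha : 0 < a) (hb : 0 < b) : 0 ≤ logDiff a b := by
  unfold logDiff
  rcases le_total a b with h | h
  · exact mul_nonneg_of_nonpos_of_nonpos (by linarith) (by linarith [log_le_log ha h])
  · exact mul_nonneg (by linarith) (by linarith [log_le_log hb h])

/-- Unnormalized entropy of `g` with respect to the uniform distribution. -/
def entSum {ι : Type*} [Fintype ι] (g : ι → ℝ) : ℝ :=
  ∑ i, g i * log (g i) - (∑ i, g i) * log ((∑ i, g i) / Fintype.card ι)

theorem log_sum_inequality {ι : Type*} [Fintype ι] [Nonempty ι] (g h : ι → ℝ)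
    (hg : ∀ i, 0 < g i) (hh : ∀ i, 0 < h i) :
    (∑ i, g i) * (log (∑ i, g i) - log (∑ i, h i)) ≤ ∑ i, g i * (log (g i) - log (h i)) := by
  have hG : 0 < ∑ i, g i := sum_pos (fun i _ => hg i) univ_nonempty
  have hH : 0 < ∑ i, h i := sum_pos (fun i _ => hh i) univ_nonempty
  set G := ∑ i, g i with hGdef
  set H := ∑ i, h i with hHdef
  have key : ∀ i, g i * (log G - log H) + g i - h i * (G / H) ≤ g i * (log (g i) - log (h i)) := by
    intro i
    have h1 := log_le_sub_one_of_pos (x := h i * G / (g i * H))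
      (div_pos (mul_pos (hh i) hG) (mul_pos (hg i) hH))
    rw [log_div (mul_pos (hh i) hG).ne' (mul_pos (hg i) hH).ne',
      log_mul (hh i).ne' hG.ne', log_mul (hg i).ne' hH.ne'] at h1
    have h2 := mul_le_mul_of_nonneg_left h1 (hg i).le
    have h3 : g i * (h i * G / (g i * H) - 1) = h i * (G / H) - g i := by
      have := (hg i).ne'
      field_simp
    linarith
  have := sum_le_sum fun i (_ : i ∈ univ) => key i
  rw [sum_sub_distrib, sum_add_distrib, ← sum_mul, ← sum_mul, ← hGdef, ← hHdef,
    mul_div_cancel₀ _ hH.ne'] at this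
  linarith

theorem logDiff_sum_le {ι : Type*} [Fintype ι] [Nonempty ι] (g h : ι → ℝ)
    (hg : ∀ i, 0 < g i) (hh : ∀ i, 0 < h i) :
    logDiff (∑ i, g i) (∑ i, h i) ≤ ∑ i, logDiff (g i) (h i) := by
  have h1 := log_sum_inequality g h hg hh
  have h2 := log_sum_inequality h g hh hg
  have h3 : ∑ i, logDiff (g i) (h i) =
      ∑ i, g i * (log (g i) - log (h i)) + ∑ i, h i * (log (h i) - log (g i)) := by
    rw [← sum_add_distrib]
    exact sum_congr rfl fun i _ => by unfold logDiff; ring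
  rw [h3]
  unfold logDiff
  linarith

theorem entSum_le_sum_logDiff {ι : Type*} [Fintype ι] [Nonempty ι] (h : ι → ℝ)
    (hh : ∀ i, 0 < h i) :
    entSum h ≤ (∑ a, ∑ b, logDiff (h a) (h b)) / (2 * Fintype.card ι) := by
  have hn : (0 : ℝ) < Fintype.card ι := by exact_mod_cast Fintype.card_pos
  have hS : 0 < ∑ i, h i := sum_pos (fun i _ => hh i) univ_nonempty
  have h1 : ∑ a, ∑ b, logDiff (h a) (h b) =
      2 * (Fintype.card ι * ∑ i, h i * log (h i)) - 2 * ((∑ i, h i) * ∑ i, log (h i)) := by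
    simp only [logDiff, sub_mul, mul_sub, sum_sub_distrib, ← sum_mul, ← mul_sum, sum_const,
      card_univ, nsmul_eq_mul, mul_assoc]
    ring
  have h2 := log_sum_inequality (fun _ : ι => (1 : ℝ)) h (fun _ => one_pos) hh
  simp only [sum_const, card_univ, nsmul_eq_mul, mul_one, log_one, zero_sub, one_mul,
    sum_neg_distrib] at h2
  unfold entSum
  rw [h1, le_div_iff₀ (by positivity), log_div hS.ne' hn.ne']
  nlinarith

theorem entSum_prod {α β : Type*} [Fintype α] [Fintype β] [Nonempty α] [Nonempty β]
    (g : α × β → ℝ) (hg : ∀ p, 0 < g p) :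
    entSum g = ∑ a, entSum (fun b => g (a, b)) + entSum (fun a => ∑ b, g (a, b)) := by
  have hα : (0 : ℝ) < Fintype.card α := by exact_mod_cast Fintype.card_pos
  have hβ : (0 : ℝ) < Fintype.card β := by exact_mod_cast Fintype.card_pos
  have hG : ∀ a, 0 < ∑ b, g (a, b) := fun a => sum_pos (fun b _ => hg _) univ_nonempty
  have hS : 0 < ∑ a, ∑ b, g (a, b) := sum_pos (fun a _ => hG a) univ_nonempty
  simp only [entSum, Fintype.sum_prod_type, Fintype.card_prod, sum_sub_distrib, Nat.cast_mul]
  rw [log_div hS.ne' (by positivity), log_div hS.ne' hα.ne', log_mul hα.ne' hβ.ne']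
  simp only [log_div (hG _).ne' hβ.ne', mul_sub, sum_sub_distrib, ← sum_mul]
  ring

theorem entSum_comp_equiv {α β : Type*} [Fintype α] [Fintype β] (e : α ≃ β) (g : β → ℝ) :
    entSum (fun a => g (e a)) = entSum g := by
  unfold entSum
  rw [Equiv.sum_comp e g, Equiv.sum_comp e fun b => g b * log (g b), Fintype.card_congr e]

open Equiv in
/-- Dirichlet-type energy of `g` along the right transposition `swap k l`. -/
def swapEnergy {n : ℕ} (g : Perm (Fin n) → ℝ) (k l : Fin n) : ℝ :=
  ∑ σ, logDiff (g σ) (g (σ * swap k l))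

open Equiv in
theorem swapEnergy_self {n : ℕ} (g : Perm (Fin n) → ℝ) (k : Fin n) : swapEnergy g k k = 0 := by
  have : swap k k = (1 : Perm (Fin n)) := swap_self k
  simp only [swapEnergy, this, mul_one, logDiff_self, sum_const_zero]

open Equiv in
theorem swapEnergy_comm {n : ℕ} (g : Perm (Fin n) → ℝ) (k l : Fin n) :
    swapEnergy g k l = swapEnergy g l k := by
  simp [swapEnergy, swap_comm k l]

open Equiv in
theorem swapEnergy_mul_right {n : ℕ} (g : Perm (Fin n) → ℝ) (ρ : Perm (Fin n)) (k l : Fin n) :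
    swapEnergy (fun σ => g (σ * ρ)) (ρ k) (ρ l) = swapEnergy g k l := by
  unfold swapEnergy
  rw [← Equiv.sum_comp (Equiv.mulRight ρ) fun σ => logDiff (g σ) (g (σ * swap k l))]
  refine sum_congr rfl fun σ _ => ?_
  have : σ * swap (ρ k) (ρ l) * ρ = σ * ρ * swap k l := by
    rw [mul_assoc, mul_assoc, mul_swap_eq_swap_mul]
  simp [this]

open Equiv in
theorem decomposeFin_symm_mul_swap_succ {n : ℕ} (a : Fin (n + 1)) (e : Perm (Fin n))
    (k l : Fin n) :
    Perm.decomposeFin.symm (a, e * swap k l) =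
      Perm.decomposeFin.symm (a, e) * swap k.succ l.succ := by
  ext i : 1
  refine Fin.cases ?_ (fun j => ?_) i
  · rw [Perm.mul_apply, swap_apply_of_ne_of_ne (Fin.succ_ne_zero _).symm (Fin.succ_ne_zero _).symm]
    simp
  · rw [Perm.mul_apply, ← (Fin.succ_injective n).map_swap]
    simp

open Equiv in
theorem sum_fiber_decomposeFin {n : ℕ} (g : Perm (Fin (n + 1)) → ℝ) (a b : Fin (n + 1)) :
    ∑ e, g (swap a b * Perm.decomposeFin.symm (a, e)) =
      ∑ e, g (Perm.decomposeFin.symm (b, e)) := by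
  have h : ∀ (c : Fin (n + 1)) (u : Perm (Fin (n + 1)) → ℝ),
      ∑ e, u (Perm.decomposeFin.symm (c, e)) = ∑ σ, if σ 0 = c then u σ else 0 := by
    intro c u
    rw [← Equiv.sum_comp Perm.decomposeFin.symm, Fintype.sum_prod_type,
      Finset.sum_eq_single c]
    · simp
    · intro d _ hd
      simp [hd]
    · simp
  rw [h a fun σ => g (swap a b * σ), h b, ← Equiv.sum_comp (Equiv.mulLeft (swap a b)) fun σ => if σ 0 = b then g σ else 0]
  refine sum_congr rfl fun σ _ => ?_
  have : swap a b (σ 0) = b ↔ σ 0 = a := by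
    rw [← Equiv.eq_symm_apply]; simp
  simp [this]

open Equiv in
theorem entSum_marginal_le {n : ℕ} (g : Perm (Fin (n + 1)) → ℝ) (hg : ∀ σ, 0 < g σ) :
    entSum (fun a => ∑ e, g (Perm.decomposeFin.symm (a, e))) ≤
      (∑ l, swapEnergy g 0 l) / (2 * (n + 1)) := by
  refine (entSum_le_sum_logDiff _ fun a => sum_pos (fun e _ => hg _) univ_nonempty).trans ?_
  rw [Fintype.card_fin]
  push_cast
  refine div_le_div_of_nonneg_right ?_ (by positivity)
  calc _ ≤ ∑ a, ∑ b, ∑ e, logDiff (g (Perm.decomposeFin.symm (a, e)))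
        (g (swap a b * Perm.decomposeFin.symm (a, e))) := by
        refine sum_le_sum fun a _ => sum_le_sum fun b _ => ?_
        rw [← sum_fiber_decomposeFin g a b]
        exact logDiff_sum_le _ _ (fun _ => hg _) (fun _ => hg _)
    _ = ∑ a, ∑ e, ∑ b, logDiff (g (Perm.decomposeFin.symm (a, e)))
        (g (swap a b * Perm.decomposeFin.symm (a, e))) :=
        sum_congr rfl fun a _ => sum_comm
    _ = ∑ a, ∑ e, ∑ l, logDiff (g (Perm.decomposeFin.symm (a, e)))
        (g (Perm.decomposeFin.symm (a, e) * swap 0 l)) := by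
        refine sum_congr rfl fun a _ => sum_congr rfl fun e _ => ?_
        rw [← Equiv.sum_comp (Perm.decomposeFin.symm (a, e))]
        refine sum_congr rfl fun l _ => ?_
        rw [mul_swap_eq_swap_mul, Perm.decomposeFin_symm_apply_zero]
    _ = ∑ l, swapEnergy g 0 l := by
        simp only [swapEnergy]
        symm
        rw [sum_comm, ← Equiv.sum_comp Perm.decomposeFin.symm, Fintype.sum_prod_type]

open Equiv in
/-- Modified logarithmic Sobolev inequality for the random transposition walk. -/
theorem entSum_perm_le {n : ℕ} (g : Perm (Fin n) → ℝ) (hg : ∀ σ, 0 < g σ) :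
    entSum g ≤ (∑ k, ∑ l, swapEnergy g k l) / (2 * n) := by
  induction n with
  | zero => simp [entSum]
  | succ n ih =>
    have step : ∀ g : Perm (Fin (n + 1)) → ℝ, (∀ σ, 0 < g σ) →
        entSum g ≤ ((∑ k, ∑ l, swapEnergy g k l) - 2 * ∑ l, swapEnergy g 0 l) / (2 * n) +
          (∑ l, swapEnergy g 0 l) / (2 * (n + 1)) := by
      intro g hg
      rw [← entSum_comp_equiv Perm.decomposeFin.symm g, entSum_prod _ fun _ => hg _]
      refine add_le_add ?_ (entSum_marginal_le g hg)
      refine (sum_le_sum fun a _ => ih (fun e => g (Perm.decomposeFin.symm (a, e)))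
        fun _ => hg _).trans_eq ?_
      rw [← sum_div]
      congr 1
      have h1 : ∀ k l, ∑ a, swapEnergy (fun e => g (Perm.decomposeFin.symm (a, e))) k l =
          swapEnergy g k.succ l.succ := by
        intro k l
        unfold swapEnergy
        rw [← Equiv.sum_comp Perm.decomposeFin.symm, Fintype.sum_prod_type]
        simp only [decomposeFin_symm_mul_swap_succ]
      rw [sum_comm]
      simp only [sum_comm (s := (univ : Finset (Fin (n + 1)))) (t := (univ : Finset (Fin n))), h1]
      rw [Fin.sum_univ_succ (fun k => ∑ l, swapEnergy g k l)]
      simp only [Fin.sum_univ_succ (fun l => swapEnergy g _ l), sum_add_distrib,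
        swapEnergy_self, swapEnergy_comm g _ 0]
      ring
    set T := ∑ k, ∑ l, swapEnergy g k l with hT
    have hi : ∀ i, entSum g ≤ (T - 2 * ∑ l, swapEnergy g i l) / (2 * n) +
        (∑ l, swapEnergy g i l) / (2 * (n + 1)) := by
      intro i
      have h := step (fun σ => g (σ * swap 0 i)) fun _ => hg _
      have hR : ∑ l, swapEnergy (fun σ => g (σ * swap 0 i)) 0 l = ∑ l, swapEnergy g i l := by
        rw [← Equiv.sum_comp (swap 0 i)]
        refine sum_congr rfl fun l _ => ?_
        rw [← swapEnergy_mul_right g (swap 0 i) i l, swap_apply_right]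
      have hT' : ∑ k, ∑ l, swapEnergy (fun σ => g (σ * swap 0 i)) k l = T := by
        rw [← Equiv.sum_comp (swap 0 i)]
        refine sum_congr rfl fun k _ => ?_
        rw [← Equiv.sum_comp (swap 0 i)]
        exact sum_congr rfl fun l _ => swapEnergy_mul_right _ _ _ _
      rw [hR, hT'] at h
      exact (entSum_comp_equiv (Equiv.mulRight (swap 0 i)) g).symm.trans_le h
    have hT0 : 0 ≤ T := sum_nonneg fun k _ => sum_nonneg fun l _ => sum_nonneg fun σ _ =>
      logDiff_nonneg (hg _) (hg _)
    have hsum := sum_le_sum fun i (_ : i ∈ univ) => hi i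
    simp only [sum_const, card_univ, Fintype.card_fin, nsmul_eq_mul, sum_add_distrib, ← sum_div,
      sum_sub_distrib, ← mul_sum] at hsum
    rw [← hT] at hsum
    push_cast at hsum ⊢
    rw [le_div_iff₀ (by positivity)]
    have hc : (((n : ℝ) + 1) * T - 2 * T) / (2 * n) + T / (2 * (n + 1)) ≤ T / 2 := by
      rcases Nat.eq_zero_or_pos n with rfl | hn
      · simp
      · have hn' : (0 : ℝ) < n := by exact_mod_cast hn
        have : T / 2 - ((((n : ℝ) + 1) * T - 2 * T) / (2 * n) + T / (2 * (n + 1))) =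
            T / (2 * n * (n + 1)) := by
          field_simp; ring
        have : 0 ≤ T / (2 * n * (n + 1)) := by positivity
        linarith
    linarith
/-- Herbst's argument for the uniform distribution on a finite type. -/
theorem log_mgf_le_of_entSum_le {ι : Type*} [Fintype ι] [Nonempty ι] (F : ι → ℝ) (C : ℝ)
    (h : ∀ s : ℝ, 0 < s → entSum (fun i => exp (s * F i)) ≤ C * s ^ 2 * ∑ i, exp (s * F i))
    {s : ℝ} (hs : 0 < s) :
    log ((∑ i, exp (s * F i)) / Fintype.card ι) ≤
      s * ((∑ i, F i) / Fintype.card ι) + C * s ^ 2 := by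
  have hn : (0 : ℝ) < Fintype.card ι := by exact_mod_cast Fintype.card_pos
  set S : ℝ → ℝ := fun s => ∑ i, exp (s * F i) with hS
  set K : ℝ → ℝ := fun s => log (S s / Fintype.card ι) with hK
  have hSpos : ∀ s, 0 < S s := fun s => sum_pos (fun i _ => exp_pos _) univ_nonempty
  have hSd : ∀ s, HasDerivAt S (∑ i, exp (s * F i) * F i) s := by
    intro s
    refine HasDerivAt.fun_sum fun i _ => ?_
    simpa using ((hasDerivAt_id s).mul_const (F i)).exp
  have hKd : ∀ s, HasDerivAt K ((∑ i, exp (s * F i) * F i) / S s) s := by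
    intro s
    have := ((hSd s).div_const (Fintype.card ι : ℝ)).log (by have := hSpos s; positivity)
    convert this using 1
    have := (hSpos s).ne'
    field_simp
  have hψd : ∀ s, 0 < s → HasDerivAt (fun s => K s / s - C * s)
      (((∑ i, exp (s * F i) * F i) / S s * s - K s * 1) / s ^ 2 - C * 1) s := fun s hs =>
    ((hKd s).div (hasDerivAt_id s) hs.ne').sub ((hasDerivAt_id s).const_mul C)
  have hanti : AntitoneOn (fun s => K s / s - C * s) (Set.Ioi 0) := by
    refine antitoneOn_of_deriv_nonpos (convex_Ioi 0)
      (fun s hs => (hψd s hs).continuousAt.continuousWithinAt)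
      (fun s hs => (hψd s (interior_subset hs)).differentiableAt.differentiableWithinAt) ?_
    intro s hs
    have hs : 0 < s := interior_subset hs
    rw [(hψd s hs).deriv]
    have h1 := h s hs
    unfold entSum at h1
    simp only [log_exp] at h1
    have h2 : ∑ i, exp (s * F i) * (s * F i) = s * ∑ i, exp (s * F i) * F i := by
      rw [mul_sum]; exact sum_congr rfl fun i _ => by ring
    rw [h2] at h1
    change s * _ - S s * K s ≤ C * s ^ 2 * S s at h1
    have h3 := hSpos s
    rw [sub_nonpos, div_le_iff₀ (by positivity)]
    have h4 : (∑ i, exp (s * F i) * F i) / S s * s - K s * 1 =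
        (s * (∑ i, exp (s * F i) * F i) - S s * K s) / S s := by
      field_simp
    rw [h4, div_le_iff₀ h3]
    linarith
  have hlim : Filter.Tendsto (fun s => K s / s - C * s) (nhdsWithin 0 (Set.Ioi 0))
      (nhds ((∑ i, F i) / Fintype.card ι)) := by
    have h0 := (hasDerivAt_iff_tendsto_slope.1 (hKd 0)).mono_left
      (nhdsWithin_mono 0 (fun y (hy : 0 < y) => hy.ne' : Set.Ioi (0 : ℝ) ⊆ {0}ᶜ))
    have h1 : Filter.Tendsto (fun s : ℝ => C * s) (nhdsWithin 0 (Set.Ioi 0)) (nhds 0) := by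
      have : Filter.Tendsto (fun s : ℝ => C * s) (nhds 0) (nhds (C * 0)) :=
        (continuous_const.mul continuous_id).tendsto 0
      rw [mul_zero] at this
      exact this.mono_left nhdsWithin_le_nhds
    have hS0 : S 0 = Fintype.card ι := by simp [hS]
    have h2 := h0.sub h1
    simp only [zero_mul, exp_zero, one_mul, hS0, sub_zero] at h2
    refine h2.congr fun y => ?_
    simp [slope_def_field, hK, hS0, hn.ne']
  have hle : K s / s - C * s ≤ (∑ i, F i) / Fintype.card ι := by
    refine ge_of_tendsto hlim ?_
    filter_upwards [Ioo_mem_nhdsGT hs] with y hy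
    exact hanti hy.1 hs hy.2.le
  have : K s / s ≤ (∑ i, F i) / Fintype.card ι + C * s := by linarith
  rw [div_le_iff₀ hs] at this
  calc _ ≤ _ := this
    _ = _ := by ring

theorem card_filter_ge_le_of_entSum_le {ι : Type*} [Fintype ι] [Nonempty ι] (F : ι → ℝ)
    {C : ℝ} (hC : 0 < C)
    (h : ∀ s : ℝ, 0 < s → entSum (fun i => exp (s * F i)) ≤ C * s ^ 2 * ∑ i, exp (s * F i))
    {t : ℝ} (ht : 0 ≤ t) :
    (#{i | F i - (∑ i, F i) / Fintype.card ι ≥ t} : ℝ) / Fintype.card ι ≤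
      exp (-(t ^ 2) / (4 * C)) := by
  have hn : (0 : ℝ) < Fintype.card ι := by exact_mod_cast Fintype.card_pos
  rcases ht.eq_or_lt with rfl | ht
  · simp only [ne_eq, OfNat.ofNat_ne_zero, not_false_eq_true, zero_pow, neg_zero, zero_div,
      exp_zero]
    rw [div_le_one hn]
    exact_mod_cast card_le_univ _
  set m := (∑ i, F i) / Fintype.card ι with hm
  set s := t / (2 * C) with hs
  have hspos : 0 < s := by positivity
  have h1 := log_mgf_le_of_entSum_le F C h hspos
  have hSpos : 0 < ∑ i, exp (s * F i) := sum_pos (fun i _ => exp_pos _) univ_nonempty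
  rw [← hm, log_le_iff_le_exp (by positivity), div_le_iff₀ hn] at h1
  have h2 : (#{i | F i - m ≥ t} : ℝ) * exp (s * (m + t)) ≤ ∑ i, exp (s * F i) := by
    rw [← nsmul_eq_mul]
    refine (card_nsmul_le_sum _ (fun i => exp (s * F i)) _ fun i hi => ?_).trans
      (sum_le_sum_of_subset_of_nonneg (subset_univ _) fun _ _ _ => (exp_pos _).le)
    have := (mem_filter.1 hi).2
    gcongr
    linarith
  rw [div_le_iff₀ hn, ← mul_le_mul_iff_left₀ (exp_pos (s * (m + t)))]
  refine (h2.trans h1).trans_eq ?_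
  rw [mul_right_comm, ← exp_add]
  congr 2
  rw [hs]
  field_simp
  ring
theorem ConvexOn.le_add_sum {E ι : Type*} [AddCommGroup E] [Module ℝ E] [Fintype ι] {s : Set E}
    {f : E → ℝ} (hf : ConvexOn ℝ s f) {p : E} (hp : p ∈ s) (y : ι → E) (hy : ∀ i, y i ∈ s)
    (c : ι → ℝ) (hc : ∀ i, 0 ≤ c i) (hc1 : ∑ i, c i ≤ 1) :
    p + ∑ i, c i • (y i - p) ∈ s ∧
      f (p + ∑ i, c i • (y i - p)) ≤ f p + ∑ i, c i * (f (y i) - f p) := by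
  let w : Option ι → ℝ := fun o => o.elim (1 - ∑ i, c i) c
  let z : Option ι → E := fun o => o.elim p y
  have hw : ∀ o ∈ univ, 0 ≤ w o := by
    rintro (_ | i) _
    · exact sub_nonneg.2 hc1
    · exact hc i
  have hw1 : ∑ o, w o = 1 := by simp [w, Fintype.sum_option]
  have hz : ∀ o ∈ univ, z o ∈ s := by
    rintro (_ | i) _
    · exact hp
    · exact hy i
  have hv : ∑ o, w o • z o = p + ∑ i, c i • (y i - p) := by
    have h1 : ∑ i, c i • (y i - p) = ∑ i, c i • y i - (∑ i, c i) • p := by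
      rw [sum_smul, ← sum_sub_distrib]
      exact sum_congr rfl fun i _ => smul_sub _ _ _
    rw [Fintype.sum_option, h1]
    change (1 - ∑ i, c i) • p + ∑ i, c i • y i = _
    rw [sub_smul, one_smul]
    abel
  rw [← hv]
  refine ⟨hf.1.sum_mem hw hw1 hz, (hf.map_sum_le hw hw1 hz).trans_eq ?_⟩
  rw [Fintype.sum_option]
  change (1 - ∑ i, c i) * f p + ∑ i, c i * f (y i) = _
  simp only [mul_sub, sum_sub_distrib, ← sum_mul]
  ring

/-- The sum of all terms of a symmetric array supported on the cross through `m`. -/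
theorem sum_sum_eq_two_mul_of_cross {ι : Type*} [Fintype ι] (c : ι → ι → ℝ) (m : ι)
    (hsymm : ∀ k l, c k l = c l k) (hm : c m m = 0)
    (h0 : ∀ k l, k ≠ m → l ≠ m → c k l = 0) :
    ∑ k, ∑ l, c k l = 2 * ∑ l, c m l := by
  have h : ∀ k, ∑ l, c k l = c m k + if k = m then ∑ l, c m l else 0 := by
    intro k
    split_ifs with hk
    · rw [hk, hm, zero_add]
    · rw [sum_eq_single m (fun l _ hl => h0 k l hk hl) (by simp), hsymm, add_zero]
  rw [sum_congr rfl fun k _ => h k, sum_add_distrib, sum_ite_eq' univ m, if_pos (mem_univ m)]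
  ring

open Equiv in
/-- The downward swap differences of a convex Lipschitz function on a cube are square summable. -/
theorem sum_sq_posPart_swap_le {N : ℕ} {a b : ℝ} {f : (Fin N → ℝ) → ℝ}
    (hconv : ConvexOn ℝ (Set.univ.pi fun _ : Fin N => Set.Icc a b) f)
    (hlip : ∀ v w : Fin N → ℝ, (∀ i, v i ∈ Set.Icc a b) → (∀ i, w i ∈ Set.Icc a b) →
      |f v - f w| ≤ Real.sqrt (∑ i, (v i - w i) ^ 2))
    (p : Fin N → ℝ) (hp : ∀ i, p i ∈ Set.Icc a b) :
    ∑ k, ∑ l, (max (f p - f (p ∘ swap k l)) 0) ^ 2 ≤ 4 * N * (b - a) ^ 2 := by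
  set d : Fin N → Fin N → ℝ := fun k l => max (f p - f (p ∘ swap k l)) 0 with hd
  set T := ∑ k, ∑ l, d k l ^ 2 with hT
  have hd0 : ∀ k l, 0 ≤ d k l := fun k l => le_max_right _ _
  have hdsymm : ∀ k l, d k l = d l k := fun k l => by simp only [hd, swap_comm k l]
  have hT0 : 0 ≤ T := sum_nonneg fun k _ => sum_nonneg fun l _ => sq_nonneg _
  set D := ∑ q : Fin N × Fin N, d q.1 q.2 with hD
  have hD0 : 0 ≤ D := sum_nonneg fun q _ => hd0 _ _
  set ε := 1 / (1 + D) with hε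
  have hεpos : 0 < ε := by positivity
  have hpmem : p ∈ Set.univ.pi fun _ : Fin N => Set.Icc a b := fun i _ => hp i
  obtain ⟨hv, hfv⟩ := hconv.le_add_sum hpmem
    (fun q : Fin N × Fin N => p ∘ swap q.1 q.2) (fun q i _ => hp _)
    (fun q => ε * d q.1 q.2) (fun q => mul_nonneg hεpos.le (hd0 _ _)) (by
      rw [← mul_sum, ← hD, hε, one_div_mul_eq_div, div_le_one (by positivity)]
      linarith)
  set v := p + ∑ q : Fin N × Fin N, (ε * d q.1 q.2) • (p ∘ swap q.1 q.2 - p) with hvdef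
  have hsum : ∑ q : Fin N × Fin N, ε * d q.1 q.2 * (f (p ∘ swap q.1 q.2) - f p) = -(ε * T) := by
    rw [hT, Fintype.sum_prod_type, mul_sum, ← sum_neg_distrib]
    refine sum_congr rfl fun k _ => ?_
    rw [mul_sum, ← sum_neg_distrib]
    refine sum_congr rfl fun l _ => ?_
    simp only [hd]
    rcases le_total (f p - f (p ∘ swap k l)) 0 with h | h
    · simp [max_eq_right h]
    · rw [max_eq_left h]; ring
  have hlow : ε * T ≤ Real.sqrt (∑ i, (p i - v i) ^ 2) := by
    have := hlip p v hp fun i => hv i trivial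
    have := le_abs_self (f p - f v)
    linarith
  have hcoord : ∀ m, p m - v m = -(ε * (2 * ∑ l, d m l * (p l - p m))) := by
    intro m
    have h1 : v m = p m + ε * ∑ k, ∑ l, d k l * (p (swap k l m) - p m) := by
      simp only [hvdef, Pi.add_apply, Finset.sum_apply, Pi.smul_apply, Pi.sub_apply,
        Function.comp_apply, smul_eq_mul, Fintype.sum_prod_type, mul_sum, mul_assoc]
    rw [h1, sum_sum_eq_two_mul_of_cross _ m]
    · simp
    · intro k l
      rw [hdsymm, swap_comm]
    · simp
    · intro k l hk hl
      rw [swap_apply_of_ne_of_ne hk.symm hl.symm]; simp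
  have hCS : ∀ m, (∑ l, d m l * (p l - p m)) ^ 2 ≤ N * (b - a) ^ 2 * ∑ l, d m l ^ 2 := by
    intro m
    have h1 := sq_sum_le_card_mul_sum_sq (s := univ) (f := fun l => d m l * (p l - p m))
    rw [card_univ, Fintype.card_fin] at h1
    refine h1.trans ?_
    rw [mul_assoc, mul_sum _ _ ((b - a) ^ 2)]
    refine mul_le_mul_of_nonneg_left (sum_le_sum fun l _ => ?_) (Nat.cast_nonneg N)
    rw [mul_pow, mul_comm]
    refine mul_le_mul_of_nonneg_right ?_ (sq_nonneg _)
    have h2 := hp l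
    have h3 := hp m
    exact sq_le_sq' (by linarith [h2.1, h3.2]) (by linarith [h2.2, h3.1])
  have hup : ∑ i, (p i - v i) ^ 2 ≤ ε ^ 2 * (4 * N * (b - a) ^ 2 * T) := by
    rw [hT, mul_sum, mul_sum]
    refine sum_le_sum fun m _ => ?_
    rw [hcoord]
    have := mul_le_mul_of_nonneg_left (hCS m) (by positivity : 0 ≤ 4 * ε ^ 2)
    linarith
  have hsq : (ε * T) ^ 2 ≤ ε ^ 2 * (4 * N * (b - a) ^ 2 * T) :=
    ((Real.le_sqrt (by positivity) (sum_nonneg fun i _ => sq_nonneg _)).1 hlow).trans hup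
  rw [mul_pow] at hsq
  replace hsq := le_of_mul_le_mul_left hsq (by positivity)
  rw [pow_two] at hsq
  rcases hT0.eq_or_lt with h | h
  · rw [← h]; positivity
  · exact le_of_mul_le_mul_right hsq h

theorem logDiff_exp_le (u v : ℝ) :
    logDiff (exp u) (exp v) ≤ max (u - v) 0 ^ 2 * exp u + max (v - u) 0 ^ 2 * exp v := by
  have key : ∀ u v : ℝ, v ≤ u → (exp u - exp v) * (u - v) ≤ (u - v) ^ 2 * exp u := by
    intro u v h
    have h1 := add_one_le_exp (v - u)
    have h2 : exp v = exp (v - u) * exp u := by rw [← exp_add]; ring_nf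
    have h3 : exp u - exp v ≤ (u - v) * exp u := by
      rw [h2]; nlinarith [exp_pos u]
    nlinarith [mul_le_mul_of_nonneg_right h3 (sub_nonneg.2 h)]
  unfold logDiff
  rw [log_exp, log_exp]
  rcases le_total u v with h | h
  · rw [max_eq_right (by linarith : u - v ≤ 0), max_eq_left (by linarith : 0 ≤ v - u)]
    linarith [key v u h]
  · rw [max_eq_left (by linarith : 0 ≤ u - v), max_eq_right (by linarith : v - u ≤ 0)]
    linarith [key u v h]

open Equiv in
theorem swapEnergy_exp_le {n : ℕ} (F : Perm (Fin n) → ℝ) (k l : Fin n) :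
    swapEnergy (fun σ => exp (F σ)) k l ≤
      2 * ∑ σ, max (F σ - F (σ * swap k l)) 0 ^ 2 * exp (F σ) := by
  refine (sum_le_sum fun σ _ => logDiff_exp_le _ _).trans_eq ?_
  rw [sum_add_distrib, two_mul]
  congr 1
  rw [← Equiv.sum_comp (Equiv.mulRight (swap k l))]
  simp [mul_assoc]

open Equiv in
theorem entSum_exp_perm_le {n : ℕ} (F : Perm (Fin n) → ℝ) {A : ℝ} (hA : 0 ≤ A)
    (hF : ∀ σ, ∑ k, ∑ l, max (F σ - F (σ * swap k l)) 0 ^ 2 ≤ 4 * n * A) {s : ℝ} (hs : 0 < s) :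
    entSum (fun σ => exp (s * F σ)) ≤ 4 * A * s ^ 2 * ∑ σ, exp (s * F σ) := by
  refine (entSum_perm_le _ fun σ => exp_pos _).trans ?_
  have h1 : ∑ k, ∑ l, swapEnergy (fun σ => exp (s * F σ)) k l ≤
      4 * A * s ^ 2 * (∑ σ, exp (s * F σ)) * (2 * n) := by
    calc _ ≤ ∑ k, ∑ l, 2 * ∑ σ, max (s * F σ - s * F (σ * swap k l)) 0 ^ 2 * exp (s * F σ) :=
          sum_le_sum fun k _ => sum_le_sum fun l _ => swapEnergy_exp_le (fun σ => s * F σ) k l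
      _ = ∑ σ, (2 * s ^ 2 * exp (s * F σ)) *
          ∑ k, ∑ l, max (F σ - F (σ * swap k l)) 0 ^ 2 := by
          simp only [mul_sum]
          rw [sum_comm' (t' := univ) (s' := fun _ => univ) (by simp)]
          rw [sum_congr rfl fun l _ => sum_comm]
          rw [sum_comm]
          refine sum_congr rfl fun σ _ => ?_
          rw [sum_comm]
          refine sum_congr rfl fun k _ => sum_congr rfl fun l _ => ?_
          have : max (s * F σ - s * F (σ * swap k l)) 0 = s * max (F σ - F (σ * swap k l)) 0 := by
            rw [mul_max_of_nonneg _ _ hs.le, mul_sub, mul_zero]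
          rw [this]
          ring
      _ ≤ ∑ σ, (2 * s ^ 2 * exp (s * F σ)) * (4 * n * A) :=
          sum_le_sum fun σ _ => mul_le_mul_of_nonneg_left (hF σ) (by positivity)
      _ = _ := by
          rw [← sum_mul, ← mul_sum]; ring
  exact div_le_of_le_mul₀ (by positivity)
    (mul_nonneg (by positivity) (sum_nonneg fun σ _ => (exp_pos _).le)) h1

open Equiv in
theorem comp_perm_mem_multislice {L N : ℕ} {κ : Fin L → ℕ} {x : Fin L → ℝ} {ω : Fin N → ℝ}
    (hω : ω ∈ multislice L N κ x) (σ : Perm (Fin N)) : ω ∘ σ ∈ multislice L N κ x := by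
  simp only [multislice, mem_filter, Fintype.mem_piFinset] at hω ⊢
  refine ⟨fun i => hω.1 _, fun ℓ => ?_⟩
  rw [← hω.2 ℓ]
  exact card_bij' (fun i _ => σ i) (fun i _ => σ.symm i) (by simp) (by simp) (by simp) (by simp)

open Equiv in
theorem exists_perm_of_mem_multislice {L N : ℕ} {κ : Fin L → ℕ} {x : Fin L → ℝ}
    {ω ω' : Fin N → ℝ} (hω : ω ∈ multislice L N κ x) (hω' : ω' ∈ multislice L N κ x) :
    ∃ τ : Perm (Fin N), ω' = ω ∘ τ := by
  simp only [multislice, mem_filter, Fintype.mem_piFinset] at hω hω'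
  have h : ∀ c : ℝ, Nonempty ({i // ω' i = c} ≃ {i // ω i = c}) := by
    intro c
    rw [← Fintype.card_eq, Fintype.card_subtype, Fintype.card_subtype]
    by_cases hc : ∃ ℓ, c = x ℓ
    · obtain ⟨ℓ, rfl⟩ := hc
      rw [hω.2, hω'.2]
    · have h0 : ∀ u : Fin N → ℝ, (∀ i, u i ∈ image x univ) → #{i | u i = c} = 0 := by
        intro u hu
        rw [card_eq_zero, filter_eq_empty_iff]
        rintro i - hi
        obtain ⟨ℓ, -, hℓ⟩ := mem_image.1 (hu i)
        exact hc ⟨ℓ, by rw [hℓ, hi]⟩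
      rw [h0 ω hω.1, h0 ω' hω'.1]
  refine ⟨Equiv.ofFiberEquiv fun c => (h c).some, ?_⟩
  ext i
  exact (Equiv.ofFiberEquiv_map _ i).symm

open Equiv in
/-- The uniform law on the multislice is the law of a uniformly permuted element. -/
theorem uexpect_multislice {L N : ℕ} {κ : Fin L → ℕ} {x : Fin L → ℝ} {ω : Fin N → ℝ}
    (hω : ω ∈ multislice L N κ x) (φ : (Fin N → ℝ) → ℝ) :
    uexpect (multislice L N κ x) φ =
      (∑ σ : Perm (Fin N), φ (ω ∘ σ)) / Fintype.card (Perm (Fin N)) := by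
  have h1 : ∀ σ : Perm (Fin N),
      ∑ u ∈ multislice L N κ x, φ (u ∘ σ) = ∑ u ∈ multislice L N κ x, φ u := by
    intro σ
    refine sum_bij' (fun u _ => u ∘ σ) (fun u _ => u ∘ σ.symm)
      (fun u hu => comp_perm_mem_multislice hu σ)
      (fun u hu => comp_perm_mem_multislice hu σ.symm) ?_ ?_ (fun _ _ => rfl)
    · intro u _; ext i; simp
    · intro u _; ext i; simp
  have h2 : ∀ u ∈ multislice L N κ x,
      ∑ σ : Perm (Fin N), φ (u ∘ σ) = ∑ σ : Perm (Fin N), φ (ω ∘ σ) := by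
    intro u hu
    obtain ⟨τ, rfl⟩ := exists_perm_of_mem_multislice hω hu
    exact Equiv.sum_comp (Equiv.mulLeft τ) fun σ => φ (ω ∘ σ)
  have h3 : (Fintype.card (Perm (Fin N)) : ℝ) * ∑ u ∈ multislice L N κ x, φ u =
      #(multislice L N κ x) * ∑ σ : Perm (Fin N), φ (ω ∘ σ) := by
    rw [← nsmul_eq_mul, ← nsmul_eq_mul, ← card_univ, ← sum_const, ← sum_const,
      ← sum_congr rfl h2, ← sum_congr rfl fun σ (_ : σ ∈ univ) => h1 σ, sum_comm]
  have hc1 : (Fintype.card (Perm (Fin N)) : ℝ) ≠ 0 := by exact_mod_cast Fintype.card_ne_zero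
  have hc2 : (#(multislice L N κ x) : ℝ) ≠ 0 := by exact_mod_cast (card_pos.2 ⟨ω, hω⟩).ne'
  unfold uexpect
  rw [div_eq_div_iff hc2 hc1]
  linarith

theorem uprob_eq_uexpect {α : Type*} (Ω : Finset α) (p : α → Prop) :
    uprob Ω p = uexpect Ω fun ω => if p ω then 1 else 0 := by
  simp [uprob, uexpect]

/-- Concentration for convex Lipschitz functions on the multislice (upper tail). -/
theorem stmt1 (L N : ℕ) (hL : 2 ≤ L) (κ : Fin L → ℕ) (hκ : ∀ ℓ, 1 ≤ κ ℓ)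
    (hN : N = ∑ ℓ, κ ℓ) (x : Fin L → ℝ) (hx : StrictMono x)
    (f : (Fin N → ℝ) → ℝ)
    (hconv : ConvexOn ℝ (Set.univ.pi fun _ : Fin N =>
      Set.Icc (x ⟨0, by omega⟩) (x ⟨L - 1, by omega⟩)) f)
    (hlip : ∀ v w : Fin N → ℝ,
      (∀ i, v i ∈ Set.Icc (x ⟨0, by omega⟩) (x ⟨L - 1, by omega⟩)) →
      (∀ i, w i ∈ Set.Icc (x ⟨0, by omega⟩) (x ⟨L - 1, by omega⟩)) →
      |f v - f w| ≤ Real.sqrt (∑ i, (v i - w i) ^ 2))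
    (t : ℝ) (ht : 0 ≤ t) :
    uprob (multislice L N κ x) (fun ω => f ω - uexpect (multislice L N κ x) f ≥ t) ≤
      Real.exp (-(t ^ 2) / (16 * (x ⟨L - 1, by omega⟩ - x ⟨0, by omega⟩) ^ 2)) := by
  rcases (multislice L N κ x).eq_empty_or_nonempty with h | ⟨ω, hω⟩
  · rw [h]
    simp only [uprob, filter_empty, card_empty, Nat.cast_zero, div_zero]
    exact (exp_pos _).le
  set a := x ⟨0, by omega⟩ with ha
  set b := x ⟨L - 1, by omega⟩ with hb
  have hab : a < b := hx (Fin.mk_lt_mk.2 (by omega))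
  have hωmem : ∀ i, ω i ∈ Set.Icc a b := by
    intro i
    obtain ⟨ℓ, -, hℓ⟩ := mem_image.1 (Fintype.mem_piFinset.1 (mem_filter.1 hω).1 i)
    rw [← hℓ]
    exact ⟨hx.monotone (Fin.le_def.2 (Nat.zero_le _)),
      hx.monotone (Fin.le_def.2 (by have := ℓ.2; simp only; omega))⟩
  have hba : 0 < (b - a) ^ 2 := by have := sub_pos.2 hab; positivity
  have hF : ∀ σ : Equiv.Perm (Fin N), ∑ k, ∑ l,
      max (f (ω ∘ σ) - f (ω ∘ (σ * Equiv.swap k l : Equiv.Perm (Fin N)))) 0 ^ 2 ≤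
        4 * N * (b - a) ^ 2 := fun σ =>
    sum_sq_posPart_swap_le hconv hlip (ω ∘ σ) fun i => hωmem _
  have key := card_filter_ge_le_of_entSum_le (fun σ : Equiv.Perm (Fin N) => f (ω ∘ σ))
    (C := 4 * (b - a) ^ 2) (by positivity)
    (fun s hs => entSum_exp_perm_le (fun σ : Equiv.Perm (Fin N) => f (ω ∘ σ)) hba.le hF hs) ht
  rw [uprob_eq_uexpect, uexpect_multislice hω, uexpect_multislice hω, sum_boole]
  refine key.trans_eq ?_
  ring_nf
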